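/- arXiv:math/0605133 — 3 statements merged into one kernel-verified Lean document; each statement's English description precedes it below -/
import Mathlib

section
/- Let 𝔤 be a finite-dimensional real Lie algebra whose Killing form is negative definite (so 𝔤 is the Lie algebra of a compact semisimple Lie group), and let 𝔥 be a Lie subalgebra of 𝔤 with 𝔥 ≠ 𝔤. Then 𝔥 has codimension at least 2 in 𝔤, i.e. dim 𝔥 + 2 ≤ dim 𝔤. -/
/-- A Lie subalgebra of a compact (negative-definite Killing form) Lie algebra which is proper
has codimension at least 2. -/
theorem lieSubalgebra_codim_two_of_killing_negDef
    (g : Type*) [LieRing g] [LieAlgebra ℝ g] [Module.Finite ℝ g]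
    (hneg : ∀ x : g, x ≠ 0 → killingForm ℝ g x x < 0)
    (H : LieSubalgebra ℝ g) (hH : H ≠ ⊤) :
    Module.finrank ℝ H + 2 ≤ Module.finrank ℝ g := by
  have anisotropic : ∀ x : g, killingForm ℝ g x x = 0 → x = 0 := fun x hx ↦ by
    by_contra h
    exact (hneg x h).ne hx
  have symm : ∀ x y : g, killingForm ℝ g x y = killingForm ℝ g y x :=
    LieModule.traceForm_comm ℝ g g
  have invariant : ∀ x y z : g, killingForm ℝ g ⁅x, y⁆ z = killingForm ℝ g x ⁅y, z⁆ :=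
    LieModule.traceForm_apply_lie_apply ℝ g g
  set K := LinearMap.BilinForm.orthogonal (killingForm ℝ g) H.toSubmodule
  have hcompl : IsCompl H.toSubmodule K := by
    refine (LinearMap.BilinForm.isCompl_orthogonal_iff_disjoint
      fun x y h ↦ (symm y x).trans h).2 (Submodule.disjoint_def.2 fun x hx hx' ↦ ?_)
    exact anisotropic x (hx' x hx)
  have hdim : Module.finrank ℝ H + Module.finrank ℝ K = Module.finrank ℝ g :=
    Submodule.finrank_add_eq_of_isCompl hcompl
  have hK0 : Module.finrank ℝ K ≠ 0 := fun h ↦ hH <| by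
    rw [Submodule.finrank_eq_zero] at h
    rw [h] at hcompl
    exact LieSubalgebra.toSubmodule_injective (eq_top_of_isCompl_bot hcompl)
  by_contra! hlt
  have hK1 : Module.finrank ℝ K = 1 := by omega
  obtain ⟨⟨v, hvK⟩, hv⟩ :=
    Module.finrank_pos_iff_exists_ne_zero.1 (Nat.pos_of_ne_zero hK0)
  have hv0 : v ≠ 0 := fun h ↦ hv (Subtype.ext h)
  have decomp : ∀ x : g, ∃ h ∈ H, ∃ c : ℝ, x = h + c • v := fun x ↦ by
    obtain ⟨h, hh, w, hw, rfl⟩ :=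
      Submodule.mem_sup.1 (hcompl.sup_eq_top ▸ Submodule.mem_top (x := x))
    obtain ⟨c, hc⟩ := exists_smul_eq_of_finrank_eq_one hK1 hv ⟨w, hw⟩
    exact ⟨h, hh, c, congrArg (h + ·) (congrArg Subtype.val hc).symm⟩
  have orth : ∀ h ∈ H, killingForm ℝ g v h = 0 := fun h hh ↦ (symm v h).trans (hvK h hh)
  have comm : ∀ h ∈ H, ⁅v, h⁆ = 0 := fun h hh ↦ by
    apply anisotropic
    obtain ⟨h', hh', c, hc⟩ := decomp ⁅v, h⁆
    have h1 : killingForm ℝ g ⁅v, h⁆ h' = 0 := by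
      rw [invariant, orth _ (H.lie_mem hh hh')]
    have h2 : killingForm ℝ g ⁅v, h⁆ v = 0 := by
      rw [symm, ← invariant, lie_self, map_zero, LinearMap.zero_apply]
    nth_rewrite 2 [hc]
    rw [map_add, map_smul, h1, h2, smul_zero, add_zero]
  have central : LieAlgebra.ad ℝ g v = 0 := by
    ext x
    obtain ⟨h, hh, c, rfl⟩ := decomp x
    simp [comm h hh]
  exact hv0 (anisotropic v (by simp [killingForm_apply_apply, central]))
end

section
/- Let 𝔤 be a finite-dimensional real Lie algebra whose Killing form B is negative definite, and let 𝔥 be a Lie subalgebra of 𝔤 of codimension exactly 2, i.e. dim 𝔥 = dim 𝔤 − 2. Let 𝔥^⊥ = {v ∈ 𝔤 : B(v,h) = 0 for all h ∈ 𝔥} be the B-orthogonal complement of 𝔥 (which is 2-dimensional). Then there exists Z ∈ 𝔥 such that for every nonzero v ∈ 𝔥^⊥ one has ⁅Z, v⁆ ∉ ℝ·v (the span of v); in other words, the adjoint action of 𝔥 rotates 𝔥^⊥, so that the corresponding connected subgroup acts transitively on the unit circle of 𝔥^⊥. -/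
open Module

/-- An anisotropic bilinear form has no nonzero vector of a plane orthogonal to two independent
vectors of that plane. -/
theorem LinearMap.BilinForm.mem_span_singleton_or_eq_zero_of_finrank_eq_two {K V : Type*} [Field K]
    [AddCommGroup V] [Module K V] {B : LinearMap.BilinForm K V} (hB : ∀ x, B x x = 0 → x = 0)
    {P : Submodule K V} (hP : finrank K P = 2) {v w x : V} (hv : v ∈ P) (hw : w ∈ P) (hx : x ∈ P)
    (hv0 : v ≠ 0) (hxv : B x v = 0) (hxw : B x w = 0) :
    w ∈ Submodule.span K {v} ∨ x = 0 := by
  by_cases hwv : w ∈ Submodule.span K {v}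
  · exact .inl hwv
  right
  have hli : LinearIndependent K ![v, w] := by
    rw [LinearIndependent.pair_iff' hv0]
    exact fun a ha ↦ hwv (Submodule.mem_span_singleton.mpr ⟨a, ha⟩)
  have : Module.Finite K P := Module.finite_of_finrank_eq_succ hP
  have hspan : Submodule.span K (Set.range ![v, w]) = P := by
    refine Submodule.eq_of_le_of_finrank_eq (Submodule.span_le.mpr ?_) ?_
    · simp [Set.insert_subset_iff, hv, hw]
    · rw [finrank_span_eq_card hli, hP, Fintype.card_fin]
  have hx' : x ∈ Submodule.span K {v, w} := by
    rwa [← Matrix.range_cons_cons_empty, hspan]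
  obtain ⟨a, b, hab⟩ := Submodule.mem_span_pair.mp hx'
  apply hB
  nth_rw 2 [← hab]
  simp [hxv, hxw]

/-- A skew-adjoint endomorphism that preserves a plane and has an eigenvector in it vanishes on
that plane. -/
theorem LinearMap.BilinForm.eq_zero_of_skew_of_finrank_eq_two {V : Type*}
    [AddCommGroup V] [Module ℝ V] {B : LinearMap.BilinForm ℝ V} (hB : ∀ x, B x x = 0 → x = 0)
    (hsymm : ∀ x y, B x y = B y x) {f : End ℝ V} (hf : ∀ x y, B (f x) y = -B x (f y))
    {P : Submodule ℝ V} (hP : finrank ℝ P = 2) (hfP : ∀ x ∈ P, f x ∈ P)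
    {v : V} (hv : v ∈ P) (hv0 : v ≠ 0) (hfv : f v ∈ Submodule.span ℝ {v})
    {w : V} (hw : w ∈ P) : f w = 0 := by
  have hself (x : V) : B (f x) x = 0 := by linarith [hf x x, hsymm x (f x)]
  obtain ⟨c, hc⟩ := Submodule.mem_span_singleton.mp hfv
  have hfv0 : f v = 0 := by
    have h := hself v
    rw [← hc, map_smul, LinearMap.smul_apply, smul_eq_mul, mul_eq_zero] at h
    rcases h with rfl | h
    · simpa using hc.symm
    · exact absurd (hB v h) hv0
  rcases mem_span_singleton_or_eq_zero_of_finrank_eq_two hB hP hv hw (hfP w hw) hv0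
    (by rw [hf, hfv0, map_zero, neg_zero]) (hself w) with h | h
  · obtain ⟨a, rfl⟩ := Submodule.mem_span_singleton.mp h
    rw [map_smul, hfv0, smul_zero]
  · exact h

theorem killingForm_lie_left {R L : Type*} [CommRing R] [LieRing L] [LieAlgebra R L] (x y z : L) :
    killingForm R L ⁅x, y⁆ z = -killingForm R L y ⁅x, z⁆ := by
  rw [← lie_skew, map_neg, LinearMap.neg_apply, LieModule.traceForm_apply_lie_apply]

/-- If `𝔥` is a codimension-2 Lie subalgebra of a Lie algebra `𝔤` with negative definite
Killing form `B`, then some `Z ∈ 𝔥` rotates the `B`-orthogonal complement `𝔥^⊥`: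
`⁅Z, v⁆` is never in the line spanned by `v` for nonzero `v ∈ 𝔥^⊥`. -/
theorem lieSubalgebra_codim_two_rotates_orthogonal_complement
    (g : Type*) [LieRing g] [LieAlgebra ℝ g] [Module.Finite ℝ g]
    (hneg : ∀ x : g, x ≠ 0 → killingForm ℝ g x x < 0)
    (H : LieSubalgebra ℝ g) (hcodim : Module.finrank ℝ H + 2 = Module.finrank ℝ g) :
    ∃ Z ∈ H, ∀ v : g, (∀ h ∈ H, killingForm ℝ g v h = 0) → v ≠ 0 →
      ⁅Z, v⁆ ∉ Submodule.span ℝ ({v} : Set g) := by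
  by_contra! hcon
  have hB (x : g) (hx : killingForm ℝ g x x = 0) : x = 0 := by
    by_contra hx0
    exact (hneg x hx0).ne hx
  have hsymm (x y : g) : killingForm ℝ g x y = killingForm ℝ g y x :=
    LieModule.traceForm_comm ℝ g g x y
  have hrefl : (killingForm ℝ g).IsRefl := fun x y h ↦ (hsymm y x).trans h
  set P := (killingForm ℝ g).orthogonal H.toSubmodule
  have hcompl : IsCompl H.toSubmodule P := by
    refine (LinearMap.BilinForm.isCompl_orthogonal_iff_disjoint hrefl).mpr ?_
    exact Submodule.disjoint_def.mpr fun x hxH hxP ↦ hB x (hxP x hxH)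
  have hP : finrank ℝ P = 2 := by
    have h := Submodule.finrank_add_eq_of_isCompl hcompl
    change finrank ℝ H + finrank ℝ P = _ at h
    lia
  have hHP {z w : g} (hz : z ∈ H) (hw : w ∈ P) : ⁅z, w⁆ = 0 := by
    obtain ⟨v, hv, hv0, hzv⟩ := hcon z hz
    refine LinearMap.BilinForm.eq_zero_of_skew_of_finrank_eq_two (f := LieAlgebra.ad ℝ g z) hB
      hsymm (killingForm_lie_left z) hP (fun x hx h hh ↦ ?_)
      (fun h hh ↦ (hsymm h v).trans (hv h hh)) hv0 hzv hw
    rw [LieAlgebra.ad_apply, hsymm, killingForm_lie_left, hsymm, hx _ (H.lie_mem hz hh), neg_zero]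
  obtain ⟨u, hu, hu0⟩ := P.exists_mem_ne_zero_of_ne_bot (Submodule.one_le_finrank_iff.mp (by lia))
  have hPu {w : g} (hw : w ∈ P) : ⁅u, w⁆ = 0 := by
    refine LinearMap.BilinForm.eq_zero_of_skew_of_finrank_eq_two (f := LieAlgebra.ad ℝ g u) hB
      hsymm (killingForm_lie_left u) hP (fun x hx h hh ↦ ?_) hu hu0 (by simp) hw
    rw [LieAlgebra.ad_apply, hsymm, killingForm_lie_left, ← lie_skew, hHP hh hu, neg_zero, map_zero,
      neg_zero]
  have had : LieAlgebra.ad ℝ g u = 0 := by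
    ext y
    obtain ⟨h, hh, p, hp, rfl⟩ := Submodule.mem_sup.mp
      (hcompl.sup_eq_top.symm ▸ Submodule.mem_top : y ∈ H.toSubmodule ⊔ P)
    simp [hPu hp, ← lie_skew u h, hHP hh hu]
  exact hu0 (hB u (by simp [killingForm_apply_apply, had]))
end

section
/- Let 𝔤 be a finite-dimensional real Lie algebra whose Killing form is negative definite, and let 𝔥 be a Lie subalgebra of 𝔤 that contains no Cartan subalgebra of 𝔤 (equivalently, for 𝔤 compact, the rank of 𝔥 is strictly smaller than the rank of 𝔤). Then 𝔥 has codimension at least 3 in 𝔤, i.e. dim 𝔥 + 3 ≤ dim 𝔤. -/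
open Module

/-- A subspace of dimension at most two is spanned by two vectors. -/
theorem Submodule.exists_span_pair_eq_of_finrank_le_two {K V : Type*} [DivisionRing K]
    [AddCommGroup V] [Module K V] [FiniteDimensional K V] (W : Submodule K V)
    (hW : finrank K W ≤ 2) : ∃ x y, Submodule.span K {x, y} = W := by
  obtain ⟨f, -, hspan, -⟩ := Submodule.exists_fun_fin_finrank_span_eq K (W : Set V)
  replace hspan := hspan.trans (Submodule.span_eq W)
  rw [← Submodule.span_eq W] at hW
  generalize finrank K (Submodule.span K (W : Set V)) = n at f hW
  interval_cases n
  · exact ⟨0, 0, by simpa using hspan⟩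
  · exact ⟨f 0, f 0, by simpa [Set.range_unique] using hspan⟩
  · refine ⟨f 0, f 1, ?_⟩
    rw [← hspan]
    congr 1
    ext
    simp [eq_comm]

/-- If `z` is central in a subalgebra `H` and acts injectively on a complement of `H` that is
stable under `z`, then `H` contains a Cartan subalgebra of the whole Lie algebra. -/
theorem LieSubalgebra.exists_isCartanSubalgebra_le {K L : Type*} [Field K] [Infinite K]
    [LieRing L] [LieAlgebra K L] [Module.Finite K L] (H : LieSubalgebra K L)
    (m : Submodule K L) (hcompl : IsCompl H.toSubmodule m) {z : L} (hz : z ∈ H)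
    (hcomm : ∀ h ∈ H, ⁅h, z⁆ = 0) (hstable : ∀ u ∈ m, ⁅u, z⁆ ∈ m)
    (hinj : ∀ u ∈ m, ⁅u, z⁆ = 0 → u = 0) :
    ∃ C : LieSubalgebra K L, C.IsCartanSubalgebra ∧ C ≤ H := by
  obtain ⟨x, hx⟩ := LieAlgebra.exists_isCartanSubalgebra_engel K H
  set D := LieSubalgebra.engel K x
  have hzD : (⟨z, hz⟩ : H) ∈ D := by
    rw [← hx.self_normalizing, mem_normalizer_iff']
    intro y _
    have : ⁅y, (⟨z, hz⟩ : H)⁆ = 0 := Subtype.ext (hcomm y y.2)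
    rw [this]
    exact D.zero_mem
  refine ⟨D.map H.incl, ⟨?_, le_antisymm ?_ (le_normalizer _)⟩, ?_⟩
  · have := hx.nilpotent
    exact (D.equivMapOfInjective H.incl Subtype.val_injective).symm.injective.lieAlgebra_isNilpotent
  · intro w hw
    rw [mem_normalizer_iff] at hw
    obtain ⟨h, hh, u, hu, rfl⟩ : ∃ h ∈ H.toSubmodule, ∃ u ∈ m, h + u = w := by
      rw [← Submodule.mem_sup, hcompl.sup_eq_top]
      trivial
    have hu0 : u = 0 := by
      obtain ⟨d, -, hd⟩ := hw z ⟨⟨z, hz⟩, hzD, rfl⟩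
      rw [add_lie, hcomm h hh, zero_add] at hd
      have hH : ⁅u, z⁆ ∈ H.toSubmodule := hd ▸ d.2
      exact hinj u hu (Submodule.disjoint_def.mp hcompl.disjoint _ hH (hstable u hu))
    subst hu0
    rw [add_zero] at hw ⊢
    refine ⟨⟨h, hh⟩, ?_, rfl⟩
    change (⟨h, hh⟩ : H) ∈ D
    rw [← hx.self_normalizing, mem_normalizer_iff]
    intro y hy
    obtain ⟨d, hd, hdy⟩ := hw y ⟨y, hy, rfl⟩
    have : d = ⁅(⟨h, hh⟩ : H), y⁆ := Subtype.ext hdy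
    exact this ▸ hd
  · rintro _ ⟨d, -, rfl⟩
    exact d.2

/-- A Lie subalgebra of a compact (negative-definite Killing form) Lie algebra which contains
no Cartan subalgebra has codimension at least 3. -/
theorem lieSubalgebra_codim_three_of_no_cartan
    (g : Type*) [LieRing g] [LieAlgebra ℝ g] [Module.Finite ℝ g]
    (hneg : ∀ x : g, x ≠ 0 → killingForm ℝ g x x < 0)
    (H : LieSubalgebra ℝ g)
    (hnoCartan : ∀ C : LieSubalgebra ℝ g, C.IsCartanSubalgebra → ¬ C ≤ H) :
    Module.finrank ℝ H + 3 ≤ Module.finrank ℝ g := by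
  set B : LinearMap.BilinForm ℝ g := killingForm ℝ g with hB
  have hdef {x : g} (h : B x x = 0) : x = 0 := by
    by_contra hx
    exact (hneg x hx).ne h
  have hsymm (x y : g) : B x y = B y x := LieModule.traceForm_comm ℝ g g x y
  have hinv (x y w : g) : B ⁅x, y⁆ w = B x ⁅y, w⁆ := LieModule.traceForm_apply_lie_apply ℝ g g x y w
  by_contra! hlt
  set m := B.orthogonal H.toSubmodule
  have hmem {u : g} : u ∈ m ↔ ∀ h ∈ H, B h u = 0 := Iff.rfl
  have hcompl : IsCompl H.toSubmodule m := by
    refine (LinearMap.BilinForm.isCompl_orthogonal_iff_disjoint fun x y h ↦ hsymm x y ▸ h).mpr ?_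
    exact Submodule.disjoint_def.mpr fun u hu hu' ↦ hdef (hu' u hu)
  have hmem_H {w : g} (hw : ∀ u ∈ m, B w u = 0) : w ∈ H := by
    obtain ⟨h, hh, u, hu, rfl⟩ : ∃ h ∈ H.toSubmodule, ∃ u ∈ m, h + u = w := by
      rw [← Submodule.mem_sup, hcompl.sup_eq_top]
      trivial
    have := hw u hu
    rw [map_add, LinearMap.add_apply, hmem.mp hu h hh, zero_add] at this
    rw [hdef this, add_zero]
    exact hh
  have hstable {h u : g} (hh : h ∈ H) (hu : u ∈ m) : ⁅h, u⁆ ∈ m := fun k hk ↦ by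
    change B k ⁅h, u⁆ = 0
    rw [← hinv]
    exact hu _ (H.lie_mem hk hh)
  have hdim : finrank ℝ m ≤ 2 := by
    have := Submodule.finrank_add_eq_of_isCompl hcompl
    change finrank ℝ H + _ = _ at this
    omega
  obtain ⟨x, y, hxy⟩ := m.exists_span_pair_eq_of_finrank_le_two hdim
  have hx : x ∈ m := hxy ▸ Submodule.subset_span (by simp)
  have hy : y ∈ m := hxy ▸ Submodule.subset_span (by simp)
  have hspan {u : g} (hu : u ∈ m) : ∃ a b : ℝ, a • x + b • y = u := by
    rwa [← hxy, Submodule.mem_span_pair] at hu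
  have hzH : ⁅x, y⁆ ∈ H := hmem_H fun u hu ↦ by
    obtain ⟨a, b, rfl⟩ := hspan hu
    have hyx : B ⁅x, y⁆ x = 0 := by rw [hsymm, ← hinv, lie_self, map_zero, LinearMap.zero_apply]
    have hxy' : B ⁅x, y⁆ y = 0 := by rw [hinv, lie_self, map_zero]
    simp [hyx, hxy']
  have hcomm (h : g) (hh : h ∈ H) : ⁅h, ⁅x, y⁆⁆ = 0 := by
    obtain ⟨a, b, hab⟩ := hspan (hstable hh hx)
    obtain ⟨c, d, hcd⟩ := hspan (hstable hh hy)
    have hscal : ⁅h, ⁅x, y⁆⁆ = (a + d) • ⁅x, y⁆ := by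
      rw [leibniz_lie, ← hab, ← hcd]
      simp [add_smul]
    have : (a + d) * B ⁅x, y⁆ ⁅x, y⁆ = 0 := by
      rw [← smul_eq_mul, ← LinearMap.smul_apply, ← map_smul, ← hscal, hinv, lie_self, map_zero]
    rcases mul_eq_zero.mp this with h0 | h0
    · rw [hscal, h0, zero_smul]
    · rw [hdef h0, lie_zero]
  obtain ⟨C, hC, hCH⟩ := H.exists_isCartanSubalgebra_le m hcompl hzH hcomm
    (fun u hu ↦ by rw [← lie_skew]; exact m.neg_mem (hstable hzH hu)) fun u hu hu0 ↦ by
      obtain ⟨a, b, rfl⟩ := hspan hu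
      rcases eq_or_ne ⁅x, y⁆ 0 with hz | hz
      · have hyx : ⁅y, x⁆ = 0 := by rw [← lie_skew, hz, neg_zero]
        have hmm {v w : g} (hv : v ∈ m) (hw : w ∈ m) : ⁅v, w⁆ = 0 := by
          obtain ⟨a, b, rfl⟩ := hspan hv
          obtain ⟨c, d, rfl⟩ := hspan hw
          simp [hz, hyx]
        generalize a • x + b • y = u at hu
        have hHu {h : g} (hh : h ∈ H) : ⁅h, u⁆ = 0 := by
          refine hdef ?_
          rw [hinv, hmm hu (hstable hh hu), map_zero]
        have had : LieAlgebra.ad ℝ g u = 0 := by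
          ext w
          obtain ⟨h, hh, v, hv, rfl⟩ : ∃ h ∈ H.toSubmodule, ∃ v ∈ m, h + v = w := by
            rw [← Submodule.mem_sup, hcompl.sup_eq_top]
            trivial
          rw [LieAlgebra.ad_apply, lie_add, hmm hu hv, ← lie_skew, hHu hh]
          simp
        refine hdef ?_
        rw [hB, killingForm_apply_apply, had]
        simp
      · have hzz : B ⁅x, y⁆ ⁅x, y⁆ ≠ 0 := fun h ↦ hz (hdef h)
        have hpair (v : g) : B ⁅x, y⁆ ⁅v, a • x + b • y⁆ = 0 := by
          rw [hsymm, hinv, hu0, map_zero]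
        have ha := hpair y
        have hb := hpair x
        rw [lie_add, lie_smul, lie_smul, lie_self, smul_zero, add_zero, ← lie_skew y x, smul_neg,
          map_neg, neg_eq_zero, map_smul, smul_eq_mul] at ha
        rw [lie_add, lie_smul, lie_smul, lie_self, smul_zero, zero_add, map_smul, smul_eq_mul] at hb
        rw [(mul_eq_zero_iff_right hzz).mp ha, (mul_eq_zero_iff_right hzz).mp hb]
        simp
  exact hnoCartan C hC hCH
end
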